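/- For every fan Σ in ℝ^d there is a finite sequence of fans Σ = Σ_0, Σ_1, …, Σ_m such that Σ_m is simplicial (every one of its cones is simplicial), each Σ_j has the same support as Σ, and for each j the fan Σ_{j+1} is the star subdivision of Σ_j along a minimal non-simplicial cone σ of Σ_j at a point v0 of the form v0 = ∑_{ρ∈σ(1)} v_ρ, where v_ρ is a chosen nonzero point on the ray ρ of σ. -/

import Mathlib

open scoped BigOperators

noncomputable section

/-- The conical hull of a set `S` in `ℝ^d`: all finite nonnegative combinations of
elements of `S`.  For a finite set `S` this is the polyhedral cone `Cone(S)`. -/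
def coneHull {d : ℕ} (S : Set (Fin d → ℝ)) : Set (Fin d → ℝ) :=
  {x | ∃ (T : Finset (Fin d → ℝ)) (c : (Fin d → ℝ) → ℝ),
    ↑T ⊆ S ∧ (∀ v ∈ T, 0 ≤ c v) ∧ x = ∑ v ∈ T, c v • v}

/-- A polyhedral cone is the conical hull of a finite set. -/
def IsPolyhedralCone {d : ℕ} (σ : Set (Fin d → ℝ)) : Prop :=
  ∃ S : Finset (Fin d → ℝ), σ = coneHull ↑S

/-- A cone is strongly convex if it contains no line through the origin. -/
def StronglyConvex {d : ℕ} (σ : Set (Fin d → ℝ)) : Prop :=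
  ∀ x ∈ σ, -x ∈ σ → x = 0

/-- `τ` is a face of `σ`: `τ = σ ∩ ker u` for a linear functional `u` nonnegative on `σ`. -/
def IsFaceOf {d : ℕ} (σ τ : Set (Fin d → ℝ)) : Prop :=
  ∃ u : (Fin d → ℝ) →ₗ[ℝ] ℝ, (∀ x ∈ σ, 0 ≤ u x) ∧ τ = {x ∈ σ | u x = 0}

/-- The dimension of the linear span of a subset of `ℝ^d`. -/
def dimSet {d : ℕ} (s : Set (Fin d → ℝ)) : ℕ :=
  Module.finrank ℝ (Submodule.span ℝ s)

/-- The set of rays (one-dimensional faces) of a cone `σ`. -/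
def raysOf {d : ℕ} (σ : Set (Fin d → ℝ)) : Set (Set (Fin d → ℝ)) :=
  {ρ | IsFaceOf σ ρ ∧ dimSet ρ = 1}

/-- The non-simplicial index `ns(σ) = |σ(1)| − dim σ`. -/
def nsCone {d : ℕ} (σ : Set (Fin d → ℝ)) : ℤ :=
  ((raysOf σ).ncard : ℤ) - (dimSet σ : ℤ)

/-- A fan in `ℝ^d`: a finite collection of strongly convex polyhedral cones, closed
under taking faces, such that the intersection of any two cones is a face of each. -/
def IsFan {d : ℕ} (F : Set (Set (Fin d → ℝ))) : Prop :=
  F.Finite ∧ (∀ σ ∈ F, IsPolyhedralCone σ ∧ StronglyConvex σ) ∧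
    (∀ σ ∈ F, ∀ τ, IsFaceOf σ τ → τ ∈ F) ∧
    (∀ σ ∈ F, ∀ σ' ∈ F, IsFaceOf σ (σ ∩ σ') ∧ IsFaceOf σ' (σ ∩ σ'))

/-- The non-simplicial index of a fan: `ns(Σ) = max_{σ ∈ Σ} ns(σ)`. -/
def nsFan {d : ℕ} (F : Set (Set (Fin d → ℝ))) : ℤ :=
  sSup (nsCone '' F)

/-- A minimal non-simplicial cone of a fan `F`: a cone of `F` whose non-simplicial index
equals `ns(F)` and which is minimal with respect to inclusion among such cones. -/
def IsMinNonSimpCone {d : ℕ} (F : Set (Set (Fin d → ℝ))) (σ : Set (Fin d → ℝ)) : Prop :=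
  σ ∈ F ∧ nsCone σ = nsFan F ∧
    ∀ τ ∈ F, nsCone τ = nsFan F → τ ⊆ σ → τ = σ

/-- The star subdivision of the fan `F` along the cone `σ` at the point `v0` (a point of
the relative interior of `σ`): it consists of the cones of `F` not containing `σ`,
together with the cones `Cone(τ ∪ {v0})` for `μ` a cone of `F` containing `σ` and
`τ` a face of `μ` not containing `σ`. -/
def starSubdiv {d : ℕ} (F : Set (Set (Fin d → ℝ))) (σ : Set (Fin d → ℝ))
    (v0 : Fin d → ℝ) : Set (Set (Fin d → ℝ)) :=
  {μ ∈ F | ¬ σ ⊆ μ} ∪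
    {c | ∃ μ ∈ F, σ ⊆ μ ∧ ∃ τ, IsFaceOf μ τ ∧ ¬ σ ⊆ τ ∧ c = coneHull (τ ∪ {v0})}

structure IsCC {d : ℕ} (C : Set (Fin d → ℝ)) : Prop where
  zero : 0 ∈ C
  add : ∀ x ∈ C, ∀ y ∈ C, x + y ∈ C
  smul : ∀ a : ℝ, 0 ≤ a → ∀ x ∈ C, a • x ∈ C

theorem IsCC.sum {d : ℕ} {C : Set (Fin d → ℝ)} (hC : IsCC C) {ι : Type*} (T : Finset ι)
    (f : ι → Fin d → ℝ) (h : ∀ i ∈ T, f i ∈ C) : ∑ i ∈ T, f i ∈ C := by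
  classical
  induction T using Finset.induction_on with
  | empty => simpa using hC.zero
  | insert a T ha ih =>
    rw [Finset.sum_insert ha]
    exact hC.add _ (h _ (Finset.mem_insert_self _ _)) _
      (ih fun i hi => h i (Finset.mem_insert_of_mem hi))

theorem coneHull_min {d : ℕ} {S C : Set (Fin d → ℝ)} (hC : IsCC C) (h : S ⊆ C) :
    coneHull S ⊆ C := by
  rintro x ⟨T, c, hT, hc, rfl⟩
  exact hC.sum _ _ fun v hv => hC.smul _ (hc v hv) _ (h (hT hv))

theorem subset_coneHull {d : ℕ} (S : Set (Fin d → ℝ)) : S ⊆ coneHull S := by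
  intro x hx
  exact ⟨{x}, fun _ => 1, by simpa using hx, by simp, by simp⟩

theorem coneHull_cc {d : ℕ} (S : Set (Fin d → ℝ)) : IsCC (coneHull S) := by
  classical
  refine ⟨⟨∅, 0, by simp, by simp, by simp⟩, ?_, ?_⟩
  · rintro _ ⟨T, c, hT, hc, rfl⟩ _ ⟨T', c', hT', hc', rfl⟩
    refine ⟨T ∪ T', fun v => (if v ∈ T then c v else 0) + (if v ∈ T' then c' v else 0), ?_, ?_, ?_⟩
    · simp [hT, hT']
    · intro v _
      refine add_nonneg ?_ ?_ <;> split_ifs with h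
      exacts [hc v h, le_rfl, hc' v h, le_rfl]
    · simp only [add_smul, Finset.sum_add_distrib, ite_smul, zero_smul]
      congr 1
      · rw [← Finset.sum_filter]; congr 1; ext; simp
      · rw [← Finset.sum_filter]; congr 1; ext; simp
  · rintro a ha _ ⟨T, c, hT, hc, rfl⟩
    exact ⟨T, fun v => a * c v, hT, fun v hv => mul_nonneg ha (hc v hv), by
      simp [Finset.smul_sum, mul_smul]⟩

theorem coneHull_mono {d : ℕ} {S T : Set (Fin d → ℝ)} (h : S ⊆ T) : coneHull S ⊆ coneHull T :=
  coneHull_min (coneHull_cc T) (h.trans (subset_coneHull T))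

theorem mem_cone_union {d : ℕ} {τ : Set (Fin d → ℝ)} (hτ : IsCC τ) (v x : Fin d → ℝ) :
    x ∈ coneHull (τ ∪ {v}) ↔ ∃ t ∈ τ, ∃ a : ℝ, 0 ≤ a ∧ x = t + a • v := by
  constructor
  · intro hx
    refine coneHull_min (C := {x | ∃ t ∈ τ, ∃ a : ℝ, 0 ≤ a ∧ x = t + a • v}) ⟨?_, ?_, ?_⟩ ?_ hx
    · exact ⟨0, hτ.zero, 0, le_rfl, by simp⟩
    · rintro _ ⟨t, ht, a, ha, rfl⟩ _ ⟨t', ht', a', ha', rfl⟩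
      exact ⟨t + t', hτ.add _ ht _ ht', a + a', add_nonneg ha ha', by module⟩
    · rintro b hb _ ⟨t, ht, a, ha, rfl⟩
      exact ⟨b • t, hτ.smul _ hb _ ht, b * a, mul_nonneg hb ha, by module⟩
    · rintro y (hy | rfl)
      · exact ⟨y, hy, 0, le_rfl, by simp⟩
      · exact ⟨0, hτ.zero, 1, by simp, by simp⟩
  · rintro ⟨t, ht, a, ha, rfl⟩
    have h := coneHull_cc (τ ∪ {v})
    exact h.add _ (subset_coneHull _ (Or.inl ht)) _
      (h.smul _ ha _ (subset_coneHull _ (Or.inr rfl)))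

theorem coneHull_union_coneHull {d : ℕ} (S : Set (Fin d → ℝ)) (v : Fin d → ℝ) :
    coneHull (coneHull S ∪ {v}) = coneHull (insert v S) := by
  apply Set.Subset.antisymm
  · apply coneHull_min (coneHull_cc _)
    rintro y (hy | rfl)
    · exact coneHull_mono (Set.subset_insert _ _) hy
    · exact subset_coneHull _ (Set.mem_insert _ _)
  · apply coneHull_min (coneHull_cc _)
    rintro y (rfl | hy)
    · exact subset_coneHull _ (Or.inr rfl)
    · exact subset_coneHull _ (Or.inl (subset_coneHull _ hy))

theorem hdesc {d : ℕ} (S : Finset (Fin d → ℝ)) :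
    ∃ U : Finset ((Fin d → ℝ) →ₗ[ℝ] ℝ), ∀ x, x ∈ coneHull (S : Set (Fin d → ℝ)) ↔
      ∀ u ∈ U, 0 ≤ u x := by
  classical
  induction S using Finset.induction_on with
  | empty =>
    refine ⟨(Finset.univ.image fun i : Fin d => LinearMap.proj i) ∪
      (Finset.univ.image fun i : Fin d => -LinearMap.proj i), fun x => ?_⟩
    constructor
    · rintro ⟨T, c, hT, -, rfl⟩
      have : T = ∅ := by simpa using hT
      subst this
      simp
    · intro h
      have : x = 0 := by
        funext i
        have h1 := h (LinearMap.proj i) (by simp)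
        have h2 := h (-LinearMap.proj i) (by simp)
        simp at h1 h2
        exact le_antisymm h2 h1
      subst this
      exact (coneHull_cc _).zero
  | insert v S _ ih =>
    obtain ⟨U, hU⟩ := ih
    refine ⟨U.filter (fun u => 0 ≤ u v) ∪ Finset.image₂ (fun u w => (u v) • w - (w v) • u)
      (U.filter (fun u => 0 < u v)) (U.filter (fun u => u v < 0)), fun x => ?_⟩
    rw [Finset.coe_insert, ← coneHull_union_coneHull, mem_cone_union (coneHull_cc _)]
    constructor
    · rintro ⟨t, ht, a, ha, rfl⟩ u hu
      rw [hU] at ht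
      simp only [Finset.mem_union, Finset.mem_filter, Finset.mem_image₂] at hu
      rcases hu with ⟨hu, h⟩ | ⟨u, ⟨hu, h⟩, w, ⟨hw, h'⟩, rfl⟩
      · simp only [map_add, map_smul, smul_eq_mul]
        have := ht u hu
        positivity
      · simp only [map_add, map_smul, smul_eq_mul, LinearMap.sub_apply, LinearMap.smul_apply]
        have := ht u hu
        have := ht w hw
        nlinarith
    · intro h
      have h1 : ∀ u ∈ U, 0 ≤ u v → 0 ≤ u x := fun u hu huv => h u (by simp [hu, huv])
      have h2 : ∀ u ∈ U, ∀ w ∈ U, 0 < u v → w v < 0 → 0 ≤ u v * w x - w v * u x := by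
        intro u hu w hw h3 h4
        have := h ((u v) • w - (w v) • u) (by
          simp only [Finset.mem_union, Finset.mem_image₂, Finset.mem_filter]
          exact Or.inr ⟨u, ⟨hu, h3⟩, w, ⟨hw, h4⟩, rfl⟩)
        simpa using this
      suffices ∃ a : ℝ, 0 ≤ a ∧ ∀ u ∈ U, 0 ≤ u x - a * u v by
        obtain ⟨a, ha, h⟩ := this
        refine ⟨x - a • v, ?_, a, ha, by simp⟩
        rw [hU]
        intro u hu
        simpa using h u hu
      rcases (U.filter (fun u => u v < 0)).eq_empty_or_nonempty with he | hne
      · refine ⟨0, le_rfl, fun u hu => ?_⟩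
        have : 0 ≤ u v := by
          by_contra hc
          have : u ∈ U.filter (fun u => u v < 0) := by simp [hu]; linarith
          simp [he] at this
        simpa using h1 u hu this
      · obtain ⟨w, hw, hmax⟩ := Finset.exists_max_image _ (fun w => w x / w v) hne
        simp only [Finset.mem_filter, and_imp] at hw hmax
        refine ⟨max 0 (w x / w v), le_max_left _ _, fun u hu => ?_⟩
        rcases lt_trichotomy (u v) 0 with h3 | h3 | h3
        · have h4 := hmax u hu h3
          have h5 : u x / u v ≤ max 0 (w x / w v) := h4.trans (le_max_right _ _)
          rw [div_le_iff_of_neg h3] at h5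
          linarith
        · have := h1 u hu h3.ge
          simpa [h3] using this
        · have h4 : max 0 (w x / w v) ≤ u x / u v := by
            apply max_le
            · exact div_nonneg (h1 u hu h3.le) h3.le
            · rw [div_le_iff_of_neg hw.2, div_mul_eq_mul_div, div_le_iff₀ h3]
              have := h2 u hu w hw.1 h3 hw.2
              linarith
          rw [le_div_iff₀ h3] at h4
          linarith

theorem IsPolyhedralCone.cc {d : ℕ} {σ : Set (Fin d → ℝ)} (h : IsPolyhedralCone σ) : IsCC σ := by
  obtain ⟨S, rfl⟩ := h
  exact coneHull_cc _

theorem IsFaceOf.subset {d : ℕ} {σ τ : Set (Fin d → ℝ)} (h : IsFaceOf σ τ) : τ ⊆ σ := by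
  obtain ⟨u, _, rfl⟩ := h
  exact fun x hx => hx.1

theorem IsFaceOf.cc {d : ℕ} {σ τ : Set (Fin d → ℝ)} (h : IsFaceOf σ τ) (hσ : IsCC σ) : IsCC τ := by
  obtain ⟨u, _, rfl⟩ := h
  refine ⟨⟨hσ.zero, by simp⟩, ?_, ?_⟩
  · rintro x ⟨hx, hx'⟩ y ⟨hy, hy'⟩
    exact ⟨hσ.add _ hx _ hy, by simp [hx', hy']⟩
  · rintro a ha x ⟨hx, hx'⟩
    exact ⟨hσ.smul _ ha _ hx, by simp [hx']⟩

theorem IsFaceOf.mem_of_add {d : ℕ} {σ τ : Set (Fin d → ℝ)} (h : IsFaceOf σ τ) {x y : Fin d → ℝ}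
    (hx : x ∈ σ) (hy : y ∈ σ) (hxy : x + y ∈ τ) : x ∈ τ ∧ y ∈ τ := by
  obtain ⟨u, hu, rfl⟩ := h
  have h1 := hu x hx
  have h2 := hu y hy
  have h3 := hxy.2
  rw [map_add] at h3
  exact ⟨⟨hx, by linarith⟩, ⟨hy, by linarith⟩⟩

theorem nonneg_cc {d : ℕ} (u : (Fin d → ℝ) →ₗ[ℝ] ℝ) : IsCC {x | 0 ≤ u x} :=
  ⟨by simp, fun x hx y hy => by simp at *; linarith, fun a ha x hx => by
    simp at *; exact mul_nonneg ha hx⟩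

theorem zero_cc {d : ℕ} (u : (Fin d → ℝ) →ₗ[ℝ] ℝ) : IsCC {x | u x = 0} :=
  ⟨by simp, fun x hx y hy => by simp at *; linarith, fun a ha x hx => by
    simp at *; right; exact hx⟩

theorem face_gen {d : ℕ} (S : Set (Fin d → ℝ)) (u : (Fin d → ℝ) →ₗ[ℝ] ℝ)
    (hu : ∀ s ∈ S, 0 ≤ u s) :
    {x ∈ coneHull S | u x = 0} = coneHull {s ∈ S | u s = 0} := by
  classical
  apply Set.Subset.antisymm
  · rintro _ ⟨⟨T, c, hT, hc, rfl⟩, h0⟩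
    simp only [map_sum, map_smul, smul_eq_mul] at h0
    rw [Finset.sum_eq_zero_iff_of_nonneg
      (fun v hv => mul_nonneg (hc v hv) (hu v (hT hv)))] at h0
    apply (coneHull_cc _).sum
    intro v hv
    rcases mul_eq_zero.1 (h0 v hv) with h | h
    · rw [h, zero_smul]; exact (coneHull_cc _).zero
    · exact (coneHull_cc _).smul _ (hc v hv) _ (subset_coneHull _ ⟨hT hv, h⟩)
  · intro x hx
    exact ⟨coneHull_mono (fun s hs => hs.1) hx, coneHull_min (zero_cc u) (fun s hs => hs.2) hx⟩

theorem IsFaceOf.poly {d : ℕ} {σ τ : Set (Fin d → ℝ)} (h : IsFaceOf σ τ)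
    (hσ : IsPolyhedralCone σ) : IsPolyhedralCone τ := by
  classical
  obtain ⟨S, rfl⟩ := hσ
  obtain ⟨u, hu, rfl⟩ := h
  refine ⟨S.filter (fun s => u s = 0), ?_⟩
  rw [face_gen _ u (fun s hs => hu s (subset_coneHull _ hs))]
  simp

theorem IsFaceOf.trans {d : ℕ} {σ τ ω : Set (Fin d → ℝ)} (hσ : IsPolyhedralCone σ)
    (h : IsFaceOf σ τ) (h' : IsFaceOf τ ω) : IsFaceOf σ ω := by
  classical
  obtain ⟨S, rfl⟩ := hσ
  obtain ⟨u, hu, rfl⟩ := h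
  obtain ⟨w, hw, rfl⟩ := h'
  have hk : ∃ k : ℝ, ∀ s ∈ S, 0 < u s → 0 < k * u s + w s := by
    obtain ⟨k, hk⟩ := (S.image fun s => (1 - w s) / u s).bddAbove
    refine ⟨k, fun s hs h => ?_⟩
    have := hk (show (1 - w s) / u s ∈ _ by simpa using ⟨s, hs, rfl⟩)
    rw [div_le_iff₀ h] at this
    linarith
  obtain ⟨k, hk⟩ := hk
  have key : ∀ s ∈ S, 0 ≤ k * u s + w s := by
    intro s hs
    rcases (hu s (subset_coneHull _ hs)).eq_or_lt with h | h
    · rw [← h]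
      simpa using hw s ⟨subset_coneHull _ hs, h.symm⟩
    · exact (hk s hs h).le
  refine ⟨k • u + w, fun x hx => coneHull_min (nonneg_cc (k • u + w)) (fun s hs => by
    simpa using key s hs) hx, ?_⟩
  apply Set.Subset.antisymm
  · rintro x ⟨⟨hx, h1⟩, h2⟩
    exact ⟨hx, by simp [h1, h2]⟩
  · rw [face_gen _ _ (fun s hs => by simpa using key s hs)]
    have hcc : IsCC {x ∈ {x ∈ coneHull (S : Set (Fin d → ℝ)) | u x = 0} | w x = 0} :=
      IsFaceOf.cc ⟨w, hw, rfl⟩ (IsFaceOf.cc ⟨u, hu, rfl⟩ (coneHull_cc _))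
    apply coneHull_min hcc
    rintro s ⟨hs, h0⟩
    simp at h0
    rcases (hu s (subset_coneHull _ hs)).eq_or_lt with h | h
    · refine ⟨⟨subset_coneHull _ hs, h.symm⟩, ?_⟩
      rw [← h] at h0
      simpa using h0
    · exact absurd h0 (hk s hs h).ne'

theorem mem_coneHull_singleton {d : ℕ} (s x : Fin d → ℝ) :
    x ∈ coneHull {s} ↔ ∃ a : ℝ, 0 ≤ a ∧ x = a • s := by
  constructor
  · intro hx
    refine coneHull_min (C := {x | ∃ a : ℝ, 0 ≤ a ∧ x = a • s}) ⟨⟨0, by simp⟩, ?_, ?_⟩ ?_ hx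
    · rintro _ ⟨a, ha, rfl⟩ _ ⟨b, hb, rfl⟩
      exact ⟨a + b, add_nonneg ha hb, by module⟩
    · rintro b hb _ ⟨a, ha, rfl⟩
      exact ⟨b * a, mul_nonneg hb ha, by module⟩
    · rintro _ rfl
      exact ⟨1, by simp⟩
  · rintro ⟨a, ha, rfl⟩
    exact (coneHull_cc _).smul _ ha _ (subset_coneHull _ rfl)

theorem dim_coneHull_singleton {d : ℕ} {s : Fin d → ℝ} (hs : s ≠ 0) : dimSet (coneHull {s}) = 1 := by
  have : Submodule.span ℝ (coneHull {s}) = Submodule.span ℝ {s} := by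
    apply le_antisymm
    · rw [Submodule.span_le]
      intro x hx
      obtain ⟨a, -, rfl⟩ := (mem_coneHull_singleton _ _).1 hx
      exact Submodule.smul_mem _ _ (Submodule.mem_span_singleton_self s)
    · exact Submodule.span_mono (subset_coneHull _)
  rw [dimSet, this, finrank_span_singleton hs]

theorem gen_rays {d : ℕ} {σ : Set (Fin d → ℝ)} (hσ : IsPolyhedralCone σ) (hsc : StronglyConvex σ) :
    ∃ S : Finset (Fin d → ℝ), σ = coneHull (S : Set (Fin d → ℝ)) ∧
      ∀ s ∈ S, s ≠ 0 ∧ coneHull {s} ∈ raysOf σ := by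
  classical
  have hex : ∃ n : ℕ, ∃ S : Finset (Fin d → ℝ), S.card = n ∧ σ = coneHull (S : Set (Fin d → ℝ)) := by
    obtain ⟨S, hS⟩ := hσ
    exact ⟨_, S, rfl, hS⟩
  obtain ⟨S, hcard, hS⟩ := Nat.find_spec hex
  have hmin : ∀ s ∈ S, s ∉ coneHull ((S.erase s : Finset _) : Set (Fin d → ℝ)) := by
    intro s hs hmem
    refine Nat.find_min hex (m := (S.erase s).card) ?_ ⟨S.erase s, rfl, ?_⟩
    · rw [← hcard]; exact Finset.card_erase_lt_of_mem hs
    · rw [hS]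
      apply Set.Subset.antisymm
      · apply coneHull_min (coneHull_cc _)
        intro t ht
        by_cases h : t = s
        · rw [h]; exact hmem
        · exact subset_coneHull _ (by simpa [h] using ht)
      · exact coneHull_mono (by simp)
  have hne : ∀ s ∈ S, s ≠ 0 := by
    rintro s hs rfl
    exact hmin _ hs (coneHull_cc _).zero
  refine ⟨S, hS, fun s hs => ⟨hne s hs, ?_, dim_coneHull_singleton (hne s hs)⟩⟩
  obtain ⟨U, hU⟩ := hdesc S
  rw [← hS] at hU
  have hsub : ∀ t ∈ S, t ∈ σ := fun t ht => by rw [hS]; exact subset_coneHull _ ht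
  have hcc : IsCC σ := by rw [hS]; exact coneHull_cc _
  set u : (Fin d → ℝ) →ₗ[ℝ] ℝ := ∑ w ∈ U.filter (fun w => w s = 0), w with hu
  have hunn : ∀ x ∈ σ, 0 ≤ u x := by
    intro x hx
    rw [hu, LinearMap.sum_apply]
    exact Finset.sum_nonneg fun w hw => (hU x).1 hx w (Finset.mem_filter.1 hw).1
  refine ⟨u, hunn, ?_⟩
  have hus : u s = 0 := by
    rw [hu, LinearMap.sum_apply]
    exact Finset.sum_eq_zero fun w hw => (Finset.mem_filter.1 hw).2
  apply Set.Subset.antisymm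
  · intro x hx
    obtain ⟨a, ha, rfl⟩ := (mem_coneHull_singleton _ _).1 hx
    exact ⟨hcc.smul _ ha _ (hsub s hs), by simp [hus]⟩
  · have : {x ∈ σ | u x = 0} = coneHull {t ∈ (S : Set (Fin d → ℝ)) | u t = 0} := by
      rw [hS]; exact face_gen _ _ fun t ht => hunn t (hsub t ht)
    rw [this]
    apply coneHull_mono
    rintro t ⟨ht, hut⟩
    have ht : t ∈ S := ht
    rw [Set.mem_singleton_iff]
    by_contra hts
    have hw0 : ∀ w ∈ U, w s = 0 → w t = 0 := by
      intro w hw hws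
      rw [hu, LinearMap.sum_apply, Finset.sum_eq_zero_iff_of_nonneg
        (fun w hw => (hU t).1 (hsub t ht) w (Finset.mem_filter.1 hw).1)] at hut
      exact hut w (by simp [hw, hws])
    have heps : ∃ ε : ℝ, 0 < ε ∧ ∀ w ∈ U, 0 ≤ w s - ε * w t := by
      obtain ⟨k, hk⟩ := (U.image fun w => w t / w s).bddAbove
      have hk1 : 0 < max k 1 := lt_max_of_lt_right one_pos
      refine ⟨(max k 1)⁻¹, inv_pos.2 hk1, fun w hw => ?_⟩
      rcases ((hU s).1 (hsub s hs) w hw).eq_or_lt with h | h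
      · rw [← h, hw0 w hw h.symm]; simp
      · have h1 : w t / w s ≤ max k 1 :=
          (hk (show w t / w s ∈ _ by simpa using ⟨w, hw, rfl⟩)).trans (le_max_left _ _)
        rw [div_le_iff₀ h] at h1
        rw [sub_nonneg, inv_mul_le_iff₀ hk1]
        exact h1
    obtain ⟨ε, hε, h⟩ := heps
    have hy : s - ε • t ∈ σ := by
      rw [hU]
      intro w hw
      simpa using h w hw
    have hy2 : s - ε • t ∈ coneHull (coneHull ((S.erase s : Finset _) : Set (Fin d → ℝ)) ∪ {s}) := by
      rw [coneHull_union_coneHull, ← Finset.coe_insert, Finset.insert_erase hs, ← hS]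
      exact hy
    obtain ⟨z, hz, b, hb, hzb⟩ := (mem_cone_union (coneHull_cc _) _ _).1 hy2
    have hte : t ∈ coneHull ((S.erase s : Finset _) : Set (Fin d → ℝ)) :=
      subset_coneHull _ (by simp [hts, ht])
    have hsum : z + ε • t ∈ coneHull ((S.erase s : Finset _) : Set (Fin d → ℝ)) :=
      (coneHull_cc _).add _ hz _ ((coneHull_cc _).smul _ hε.le _ hte)
    have heq : (1 - b) • s = z + ε • t := by
      rw [sub_smul, one_smul, sub_eq_iff_eq_add]
      rw [sub_eq_iff_eq_add] at hzb
      have h3 : z + ε • t + b • s = z + b • s + ε • t := by abel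
      rw [h3]; exact hzb
    rcases lt_or_ge b 1 with hb1 | hb1
    · apply hmin s hs
      have : s = (1 - b)⁻¹ • (z + ε • t) := by
        rw [← heq, smul_smul, inv_mul_cancel₀ (by linarith), one_smul]
      have h4 := (coneHull_cc _).smul (1 - b)⁻¹ (inv_nonneg.2 (by linarith)) _ hsum
      rwa [← this] at h4
    · have h0 : ε • t = 0 := by
        apply hsc _ (hcc.smul _ hε.le _ (hsub t ht))
        have : -(ε • t) = z + (b - 1) • s := by
          have : z + (b-1) • s = z - (1 - b) • s := by module
          rw [this, heq]; abel
        rw [this]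
        refine hcc.add _ ?_ _ (hcc.smul _ (by linarith) _ (hsub s hs))
        rw [hS]
        exact coneHull_mono (by simp) hz
      rcases smul_eq_zero.1 h0 with h | h
      · exact hε.ne' h
      · exact hne t ht h

theorem rays_le {d : ℕ} {σ : Set (Fin d → ℝ)} (hσ : IsPolyhedralCone σ) (hsc : StronglyConvex σ)
    (W : Submodule ℝ (Fin d → ℝ)) (h : ∀ ρ ∈ raysOf σ, ρ ⊆ W) : σ ⊆ W := by
  obtain ⟨S, hS, hr⟩ := gen_rays hσ hsc
  rw [hS]
  refine coneHull_min ⟨W.zero_mem, fun x hx y hy => W.add_mem hx hy,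
    fun a _ x hx => W.smul_mem _ hx⟩ fun s hs => h _ (hr s hs).2 (subset_coneHull _ rfl)

theorem ray_span {d : ℕ} {ρ : Set (Fin d → ℝ)} (h : dimSet ρ = 1) {v : Fin d → ℝ} (hv : v ∈ ρ)
    (h0 : v ≠ 0) : Submodule.span ℝ ρ = Submodule.span ℝ {v} := by
  symm
  apply Submodule.eq_of_le_of_finrank_eq
  · exact Submodule.span_mono (by simpa using hv)
  · rw [finrank_span_singleton h0]; exact h.symm

theorem ray_exists {d : ℕ} {ρ : Set (Fin d → ℝ)} (h : dimSet ρ = 1) : ∃ v ∈ ρ, v ≠ 0 := by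
  by_contra! hc
  have : Submodule.span ℝ ρ = ⊥ := by
    rw [Submodule.span_eq_bot]; exact hc
  rw [dimSet, this] at h
  simp at h

theorem IsFaceOf.sc {d : ℕ} {σ τ : Set (Fin d → ℝ)} (h : IsFaceOf σ τ) (hs : StronglyConvex σ) :
    StronglyConvex τ := fun x hx hx' => hs x (h.subset hx) (h.subset hx')

section star

variable {d : ℕ} {F : Set (Set (Fin d → ℝ))} {σ : Set (Fin d → ℝ)} {v0 : Fin d → ℝ}

theorem star_cancel (hF : IsFan F) (hv : v0 ∈ σ)
    (hrel : ∀ τ ∈ F, v0 ∈ τ → σ ⊆ τ) {μ μ' : Set (Fin d → ℝ)} (hμ : μ ∈ F) (hσμ : σ ⊆ μ)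
    (hμ' : μ' ∈ F) (hn : ¬ σ ⊆ μ') {y : Fin d → ℝ} (hy : y ∈ μ) {a : ℝ} (ha : 0 ≤ a)
    (h : y + a • v0 ∈ μ') : a = 0 := by
  by_contra hne
  have hcc := (hF.2.1 μ hμ).1.cc
  have h1 := (hF.2.2.2 μ hμ μ' hμ').1
  have hav : a • v0 ∈ μ := hcc.smul _ ha _ (hσμ hv)
  have h2 := (h1.mem_of_add hy hav ⟨hcc.add _ hy _ hav, h⟩).2
  have h3 := (h1.cc hcc).smul a⁻¹ (inv_nonneg.2 ha) _ h2
  rw [smul_smul, inv_mul_cancel₀ hne, one_smul] at h3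
  exact hn (hrel μ' hμ' h3.2)

/-- faces of `Cone(τ, v0)` -/
theorem face_cone {τ : Set (Fin d → ℝ)} (hτ : IsCC τ) {u : (Fin d → ℝ) →ₗ[ℝ] ℝ}
    (hu : ∀ x ∈ τ, u x = 0) (huv : 0 < u v0) {ω : Set (Fin d → ℝ)} (hω : IsFaceOf τ ω) :
    IsFaceOf (coneHull (τ ∪ {v0})) ω ∧ IsFaceOf (coneHull (τ ∪ {v0})) (coneHull (ω ∪ {v0})) := by
  have hωc := hω.cc hτ
  obtain ⟨w, hw, rfl⟩ := hω
  have hw0 : w v0 / u v0 * u v0 = w v0 := div_mul_cancel₀ _ huv.ne'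
  have hw1 : (1 - w v0) / u v0 * u v0 = 1 - w v0 := div_mul_cancel₀ _ huv.ne'
  constructor
  · refine ⟨w + ((1 - w v0) / u v0) • u, ?_, ?_⟩
    · intro x hx
      obtain ⟨t, ht, a, ha, rfl⟩ := (mem_cone_union hτ _ _).1 hx
      have := hw t ht
      simp [hu t ht]
      rw [mul_left_comm, hw1]
      nlinarith
    · ext x
      constructor
      · rintro ⟨hx, hx'⟩
        exact ⟨subset_coneHull _ (Or.inl hx), by simp [hx', hu x hx]⟩
      · rintro ⟨hx, h0⟩
        obtain ⟨t, ht, a, ha, rfl⟩ := (mem_cone_union hτ _ _).1 hx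
        have := hw t ht
        simp [hu t ht] at h0
        rw [mul_left_comm, hw1] at h0
        have ha0 : a = 0 := by nlinarith
        subst ha0
        simp at h0 ⊢
        exact ⟨ht, h0⟩
  · refine ⟨w - (w v0 / u v0) • u, ?_, ?_⟩
    · intro x hx
      obtain ⟨t, ht, a, ha, rfl⟩ := (mem_cone_union hτ _ _).1 hx
      have := hw t ht
      simp [hu t ht]
      rw [mul_left_comm, hw0]
      nlinarith
    · ext x
      rw [Set.mem_ofPred_eq, mem_cone_union hτ, mem_cone_union hωc]
      constructor
      · rintro ⟨t, ⟨ht, ht'⟩, a, ha, rfl⟩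
        refine ⟨⟨t, ht, a, ha, rfl⟩, ?_⟩
        simp [hu t ht, ht']
        rw [mul_left_comm, hw0]; ring
      · rintro ⟨⟨t, ht, a, ha, rfl⟩, h0⟩
        simp [hu t ht] at h0
        rw [mul_left_comm, hw0] at h0
        exact ⟨t, ⟨ht, by linarith⟩, a, ha, rfl⟩

theorem face_cone_inv {τ : Set (Fin d → ℝ)} (hτ : IsCC τ) {κ : Set (Fin d → ℝ)}
    (h : IsFaceOf (coneHull (τ ∪ {v0})) κ) :
    ∃ ω, IsFaceOf τ ω ∧ (κ = ω ∨ κ = coneHull (ω ∪ {v0})) := by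
  obtain ⟨w, hw, rfl⟩ := h
  have hwτ : ∀ x ∈ τ, 0 ≤ w x := fun x hx => hw x (subset_coneHull _ (Or.inl hx))
  have hwv : 0 ≤ w v0 := hw v0 (subset_coneHull _ (Or.inr rfl))
  have hf : IsFaceOf τ {x ∈ τ | w x = 0} := ⟨w, hwτ, rfl⟩
  refine ⟨_, hf, ?_⟩
  rcases hwv.eq_or_lt with h | h
  · right
    ext x
    rw [Set.mem_ofPred_eq, mem_cone_union hτ, mem_cone_union (hf.cc hτ)]
    constructor
    · rintro ⟨⟨t, ht, a, ha, rfl⟩, h0⟩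
      simp [← h] at h0
      exact ⟨t, ⟨ht, h0⟩, a, ha, rfl⟩
    · rintro ⟨t, ⟨ht, ht'⟩, a, ha, rfl⟩
      exact ⟨⟨t, ht, a, ha, rfl⟩, by simp [ht', ← h]⟩
  · left
    ext x
    rw [Set.mem_ofPred_eq, mem_cone_union hτ]
    constructor
    · rintro ⟨⟨t, ht, a, ha, rfl⟩, h0⟩
      have := hwτ t ht
      simp at h0
      have ha0 : a = 0 := by nlinarith
      subst ha0
      simp at h0 ⊢
      exact ⟨ht, h0⟩
    · rintro ⟨hx, h0⟩
      exact ⟨⟨x, hx, 0, le_rfl, by simp⟩, h0⟩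

theorem star_func (hv : v0 ∈ σ) (hrel : ∀ τ ∈ F, v0 ∈ τ → σ ⊆ τ)
    {μ τ : Set (Fin d → ℝ)} (hσμ : σ ⊆ μ) (hτ : IsFaceOf μ τ) (hτF : τ ∈ F) (hn : ¬ σ ⊆ τ) :
    ∃ u : (Fin d → ℝ) →ₗ[ℝ] ℝ, (∀ x ∈ τ, u x = 0) ∧ 0 < u v0 := by
  obtain ⟨u, hu, rfl⟩ := hτ
  refine ⟨u, fun x hx => hx.2, lt_of_le_of_ne (hu _ (hσμ hv)) fun h => hn (hrel _ hτF ?_)⟩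
  exact ⟨hσμ hv, h.symm⟩

theorem cone_subset {μ τ : Set (Fin d → ℝ)} (hμ : IsCC μ) (h : τ ⊆ μ) (hv : v0 ∈ μ) :
    coneHull (τ ∪ {v0}) ⊆ μ := by
  apply coneHull_min hμ
  rintro y (hy | rfl)
  exacts [h hy, hv]

theorem star_inter_old (hF : IsFan F) (hv : v0 ∈ σ)
    (hrel : ∀ τ ∈ F, v0 ∈ τ → σ ⊆ τ) {μ μ' τ : Set (Fin d → ℝ)} (hμ : μ ∈ F) (hσμ : σ ⊆ μ)
    (hτ : IsFaceOf μ τ)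
    (hμ' : μ' ∈ F) (hn : ¬ σ ⊆ μ') : coneHull (τ ∪ {v0}) ∩ μ' = τ ∩ μ' := by
  have hτc := hτ.cc (hF.2.1 μ hμ).1.cc
  apply Set.Subset.antisymm
  · rintro x ⟨hx, hx'⟩
    obtain ⟨t, ht, a, ha, rfl⟩ := (mem_cone_union hτc _ _).1 hx
    have := star_cancel hF hv hrel hμ hσμ hμ' hn (hτ.subset ht) ha hx'
    subst this
    simp at hx' ⊢
    exact ⟨ht, hx'⟩
  · exact Set.inter_subset_inter_left _ (fun x hx => subset_coneHull _ (Or.inl hx))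

theorem star_inter_new (hF : IsFan F) (hv : v0 ∈ σ)
    (hrel : ∀ τ ∈ F, v0 ∈ τ → σ ⊆ τ) {μ μ' τ τ' : Set (Fin d → ℝ)} (hμ : μ ∈ F) (hσμ : σ ⊆ μ)
    (hτ : IsFaceOf μ τ) (hn : ¬ σ ⊆ τ)
    (hμ' : μ' ∈ F) (hσμ' : σ ⊆ μ') (hτ' : IsFaceOf μ' τ') (hn' : ¬ σ ⊆ τ') :
    coneHull (τ ∪ {v0}) ∩ coneHull (τ' ∪ {v0}) = coneHull ((τ ∩ τ') ∪ {v0}) := by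
  have hτc := hτ.cc (hF.2.1 μ hμ).1.cc
  have hτc' := hτ'.cc (hF.2.1 μ' hμ').1.cc
  have hτF := hF.2.2.1 μ hμ τ hτ
  have hτF' := hF.2.2.1 μ' hμ' τ' hτ'
  apply Set.Subset.antisymm
  · rintro x ⟨hx, hx'⟩
    obtain ⟨t, ht, a, ha, rfl⟩ := (mem_cone_union hτc _ _).1 hx
    obtain ⟨t', ht', a', ha', heq⟩ := (mem_cone_union hτc' _ _).1 hx'
    have haa : a = a' := by
      rcases le_total a a' with h | h
      · have h1 : t' + (a' - a) • v0 = t := by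
          rw [sub_smul, add_sub, ← heq]; simp
        have := star_cancel hF hv hrel hμ' hσμ' hτF hn (hτ'.subset ht') (sub_nonneg.2 h)
          (by rw [h1]; exact ht)
        linarith
      · have h1 : t + (a - a') • v0 = t' := by
          rw [sub_smul, add_sub, heq]; simp
        have := star_cancel hF hv hrel hμ hσμ hτF' hn' (hτ.subset ht) (sub_nonneg.2 h)
          (by rw [h1]; exact ht')
        linarith
    subst haa
    have htt : t = t' := add_right_cancel heq
    subst htt
    exact (coneHull_cc _).add _ (subset_coneHull _ (Or.inl ⟨ht, ht'⟩)) _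
      ((coneHull_cc _).smul _ ha _ (subset_coneHull _ (Or.inr rfl)))
  · apply Set.subset_inter
    · exact coneHull_mono (Set.union_subset_union_left _ Set.inter_subset_left)
    · exact coneHull_mono (Set.union_subset_union_left _ Set.inter_subset_right)

theorem star_isFan (hF : IsFan F) (hv : v0 ∈ σ)
    (hrel : ∀ τ ∈ F, v0 ∈ τ → σ ⊆ τ) : IsFan (starSubdiv F σ v0) := by
  classical
  refine ⟨?_, ?_, ?_, ?_⟩
  · apply (hF.1.union (hF.1.image fun τ => coneHull (τ ∪ {v0}))).subset
    rintro c (⟨hc, -⟩ | ⟨μ, hμ, -, τ, hτ, -, rfl⟩)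
    · exact Or.inl hc
    · exact Or.inr ⟨τ, hF.2.2.1 μ hμ τ hτ, rfl⟩
  · rintro c (⟨hc, -⟩ | ⟨μ, hμ, hσμ, τ, hτ, -, rfl⟩)
    · exact hF.2.1 c hc
    · obtain ⟨hp, hs⟩ := hF.2.1 μ hμ
      refine ⟨?_, fun x hx hx' => hs x ?_ ?_⟩
      · obtain ⟨S, rfl⟩ := hτ.poly hp
        exact ⟨insert v0 S, by rw [coneHull_union_coneHull, Finset.coe_insert]⟩
      · exact cone_subset hp.cc hτ.subset (hσμ hv) hx
      · exact cone_subset hp.cc hτ.subset (hσμ hv) hx'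
  · rintro c (⟨hc, hn⟩ | ⟨μ, hμ, hσμ, τ, hτ, hn, rfl⟩) κ hκ
    · exact Or.inl ⟨hF.2.2.1 c hc κ hκ, fun h => hn (h.trans hκ.subset)⟩
    · have hp := (hF.2.1 μ hμ).1
      obtain ⟨ω, hω, h⟩ := face_cone_inv (hτ.cc hp.cc) hκ
      have hωμ := IsFaceOf.trans hp hτ hω
      have hn' : ¬ σ ⊆ ω := fun h => hn (h.trans hω.subset)
      rcases h with rfl | rfl
      · exact Or.inl ⟨hF.2.2.1 μ hμ _ hωμ, hn'⟩
      · exact Or.inr ⟨μ, hμ, hσμ, ω, hωμ, hn', rfl⟩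
  · have key : ∀ c ∈ {μ ∈ F | ¬ σ ⊆ μ}, ∀ μ ∈ F, σ ⊆ μ → ∀ τ, IsFaceOf μ τ → ¬ σ ⊆ τ →
        IsFaceOf (coneHull (τ ∪ {v0})) (coneHull (τ ∪ {v0}) ∩ c) ∧
        IsFaceOf c (coneHull (τ ∪ {v0}) ∩ c) := by
      rintro c ⟨hc, hnc⟩ μ hμ hσμ τ hτ hn
      rw [star_inter_old hF hv hrel hμ hσμ hτ hc hnc]
      have hτF := hF.2.2.1 μ hμ τ hτ
      obtain ⟨u, hu, huv⟩ := star_func hv hrel hσμ hτ hτF hn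
      have h := hF.2.2.2 τ hτF c hc
      exact ⟨(face_cone (hτ.cc (hF.2.1 μ hμ).1.cc) hu huv h.1).1, h.2⟩
    rintro c hc1 c' hc1'
    rcases hc1 with hc | ⟨μ, hμ, hσμ, τ, hτ, hn, rfl⟩ <;>
    rcases hc1' with hc' | ⟨μ', hμ', hσμ', τ', hτ', hn', rfl⟩
    · exact hF.2.2.2 c hc.1 c' hc'.1
    · rw [Set.inter_comm]
      exact (key c hc μ' hμ' hσμ' τ' hτ' hn').symm
    · exact key c' hc' μ hμ hσμ τ hτ hn
    · rw [star_inter_new hF hv hrel hμ hσμ hτ hn hμ' hσμ' hτ' hn']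
      have hτF := hF.2.2.1 μ hμ τ hτ
      have hτF' := hF.2.2.1 μ' hμ' τ' hτ'
      obtain ⟨u, hu, huv⟩ := star_func hv hrel hσμ hτ hτF hn
      obtain ⟨u', hu', huv'⟩ := star_func hv hrel hσμ' hτ' hτF' hn'
      have h := hF.2.2.2 τ hτF τ' hτF'
      exact ⟨(face_cone (hτ.cc (hF.2.1 μ hμ).1.cc) hu huv h.1).2,
        (face_cone (hτ'.cc (hF.2.1 μ' hμ').1.cc) hu' huv' h.2).2⟩

theorem star_support (hF : IsFan F) (hv : v0 ∈ σ) (hv0 : v0 ≠ 0) :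
    ⋃₀ (starSubdiv F σ v0) = ⋃₀ F := by
  classical
  apply Set.Subset.antisymm
  · rintro x ⟨c, (⟨hc, -⟩ | ⟨μ, hμ, hσμ, τ, hτ, -, rfl⟩), hx⟩
    · exact ⟨c, hc, hx⟩
    · exact ⟨μ, hμ, cone_subset (hF.2.1 μ hμ).1.cc hτ.subset (hσμ hv) hx⟩
  · rintro x ⟨μ, hμ, hx⟩
    by_cases hσμ : σ ⊆ μ
    swap
    · exact ⟨μ, Or.inl ⟨hμ, hσμ⟩, hx⟩
    obtain ⟨hp, hs⟩ := hF.2.1 μ hμ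
    have hcc := hp.cc
    obtain ⟨S, hS⟩ := hp
    obtain ⟨U, hU⟩ := hdesc S
    rw [← hS] at hU
    have hne : (U.filter fun u => 0 < u v0).Nonempty := by
      by_contra hc
      rw [Finset.not_nonempty_iff_eq_empty, Finset.filter_eq_empty_iff] at hc
      apply hv0
      apply hs _ (hσμ hv)
      rw [hU]
      intro u hu
      have := hc hu
      simp at this ⊢
      exact this
    obtain ⟨u, hu, hmin⟩ := Finset.exists_min_image _ (fun u => u x / u v0) hne
    simp only [Finset.mem_filter, and_imp] at hu hmin
    set a := u x / u v0 with ha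
    have ha0 : 0 ≤ a := div_nonneg ((hU x).1 hx u hu.1) hu.2.le
    have hax : a * u v0 = u x := div_mul_cancel₀ _ hu.2.ne'
    have ht : x - a • v0 ∈ μ := by
      rw [hU]
      intro w hw
      simp
      rcases ((hU v0).1 (hσμ hv) w hw).eq_or_lt with h | h
      · rw [← h]; simpa using (hU x).1 hx w hw
      · have := hmin w hw h
        rwa [le_div_iff₀ h] at this
    have hf : IsFaceOf μ {y ∈ μ | u y = 0} := ⟨u, fun y hy => (hU y).1 hy u hu.1, rfl⟩
    refine ⟨_, Or.inr ⟨μ, hμ, hσμ, _, hf, fun h => hu.2.ne' (h hv).2, rfl⟩, ?_⟩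
    rw [mem_cone_union (hf.cc hcc)]
    exact ⟨x - a • v0, ⟨ht, by simp [hax]⟩, a, ha0, by simp⟩

end star

theorem rank_rays {d : ℕ} {R : Set (Set (Fin d → ℝ))} (hR : R.Finite) (h : ∀ ρ ∈ R, dimSet ρ = 1) :
    Module.finrank ℝ (Submodule.span ℝ (⋃₀ R)) ≤ R.ncard := by
  induction R, hR using Set.Finite.induction_on with
  | empty => simp
  | @insert ρ R hρ hR ih =>
    rw [Set.ncard_insert_of_notMem hρ hR, Set.sUnion_insert, Submodule.span_union]
    have h1 := ih fun ρ' h' => h ρ' (Set.mem_insert_of_mem _ h')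
    have h2 : Module.finrank ℝ (Submodule.span ℝ ρ) = 1 := h ρ (Set.mem_insert _ _)
    have h3 := Submodule.finrank_add_le_finrank_add_finrank (Submodule.span ℝ ρ)
      (Submodule.span ℝ (⋃₀ R))
    omega

theorem rays_finite {d : ℕ} {F : Set (Set (Fin d → ℝ))} (hF : IsFan F) {σ : Set (Fin d → ℝ)}
    (hσ : σ ∈ F) : (raysOf σ).Finite :=
  hF.1.subset fun ρ hρ => hF.2.2.1 σ hσ ρ hρ.1

theorem ns_nonneg {d : ℕ} {F : Set (Set (Fin d → ℝ))} (hF : IsFan F) {σ : Set (Fin d → ℝ)}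
    (hσ : σ ∈ F) : 0 ≤ nsCone σ := by
  obtain ⟨hp, hs⟩ := hF.2.1 σ hσ
  have h1 := rank_rays (rays_finite hF hσ) (fun ρ hρ => hρ.2)
  have h2 : Submodule.span ℝ σ ≤ Submodule.span ℝ (⋃₀ raysOf σ) :=
    Submodule.span_le.2 (rays_le hp hs _ fun ρ hρ x hx => Submodule.subset_span ⟨ρ, hρ, hx⟩)
  have h3 := Submodule.finrank_mono h2
  unfold nsCone dimSet
  omega

theorem ns_face_lt {d : ℕ} {F : Set (Set (Fin d → ℝ))} (hF : IsFan F) {σ : Set (Fin d → ℝ)}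
    (hσ : σ ∈ F) (hmax : ∀ κ ∈ F, nsCone κ ≤ nsCone σ)
    (hmin : ∀ κ ∈ F, nsCone κ = nsCone σ → κ ⊆ σ → κ = σ) {μ τ : Set (Fin d → ℝ)}
    (hμ : μ ∈ F) (hσμ : σ ⊆ μ) (hτ : IsFaceOf μ τ) (hn : ¬ σ ⊆ τ) : nsCone τ < nsCone σ := by
  classical
  obtain ⟨hp, hs⟩ := hF.2.1 μ hμ
  have hτF := hF.2.2.1 μ hμ τ hτ
  have hfσ : IsFaceOf μ σ := by
    have := (hF.2.2.2 μ hμ σ hσ).1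
    rwa [Set.inter_eq_right.2 hσμ] at this
  have hf' : IsFaceOf σ (σ ∩ τ) := (hF.2.2.2 σ hσ τ hτF).1
  have hσ' : σ ∩ τ ∈ F := hF.2.2.1 σ hσ _ hf'
  have hlt : nsCone (σ ∩ τ) < nsCone σ := by
    refine lt_of_le_of_ne (hmax _ hσ') fun h => hn ?_
    have := hmin _ hσ' h Set.inter_subset_left
    exact Set.inter_eq_left.1 this
  have hsub : raysOf σ ⊆ raysOf μ := fun ρ hρ => ⟨IsFaceOf.trans hp hfσ hρ.1, hρ.2⟩
  have hfinμ := rays_finite hF hμ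
  have hfinτ := rays_finite hF hτF
  have hE : raysOf τ \ raysOf (σ ∩ τ) ⊆ raysOf μ \ raysOf σ := by
    rintro ρ ⟨hρ, hρ'⟩
    refine ⟨⟨IsFaceOf.trans hp hτ hρ.1, hρ.2⟩, fun hρσ => hρ' ⟨?_, hρ.2⟩⟩
    have hsσ := hρσ.1.subset
    have hsτ := hρ.1.subset
    obtain ⟨w, hw, hρe⟩ := hρ.1
    refine ⟨w, fun x hx => hw x hx.2, ?_⟩
    ext x
    constructor
    · intro hx
      have : x ∈ {x ∈ τ | w x = 0} := hρe ▸ hx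
      exact ⟨⟨hsσ hx, hsτ hx⟩, this.2⟩
    · rintro ⟨hx, h0⟩
      rw [hρe]
      exact ⟨hx.2, h0⟩
  have c1 : (raysOf μ \ raysOf σ).ncard + (raysOf σ).ncard = (raysOf μ).ncard :=
    Set.ncard_sdiff_add_ncard_of_subset hsub hfinμ
  have c2 : ((raysOf μ \ raysOf σ) \ (raysOf τ \ raysOf (σ ∩ τ))).ncard +
      (raysOf τ \ raysOf (σ ∩ τ)).ncard = (raysOf μ \ raysOf σ).ncard :=
    Set.ncard_sdiff_add_ncard_of_subset hE (hfinμ.subset Set.sdiff_subset)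
  have c3 : (raysOf τ).ncard ≤ (raysOf τ \ raysOf (σ ∩ τ)).ncard + (raysOf (σ ∩ τ)).ncard :=
    Set.ncard_le_ncard_sdiff_add_ncard _ _ (rays_finite hF hσ')
  have d1 := Submodule.finrank_sup_add_finrank_inf_eq (Submodule.span ℝ σ) (Submodule.span ℝ τ)
  have d2 : dimSet (σ ∩ τ) ≤ Module.finrank ℝ
      (Submodule.span ℝ σ ⊓ Submodule.span ℝ τ : Submodule ℝ (Fin d → ℝ)) :=
    Submodule.finrank_mono (le_inf (Submodule.span_mono Set.inter_subset_left)
      (Submodule.span_mono Set.inter_subset_right))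
  have d3 := rank_rays (R := (raysOf μ \ raysOf σ) \ (raysOf τ \ raysOf (σ ∩ τ)))
    ((hfinμ.subset Set.sdiff_subset).subset Set.sdiff_subset) (fun ρ hρ => hρ.1.1.2)
  have d4 := Submodule.finrank_add_le_finrank_add_finrank
    (Submodule.span ℝ σ ⊔ Submodule.span ℝ τ)
    (Submodule.span ℝ (⋃₀ ((raysOf μ \ raysOf σ) \ (raysOf τ \ raysOf (σ ∩ τ)))))
  have d5 : Submodule.span ℝ μ ≤ (Submodule.span ℝ σ ⊔ Submodule.span ℝ τ) ⊔
    (Submodule.span ℝ (⋃₀ ((raysOf μ \ raysOf σ) \ (raysOf τ \ raysOf (σ ∩ τ))))) := by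
    rw [Submodule.span_le]
    apply rays_le hp hs
    intro ρ hρ x hx
    by_cases h1 : ρ ∈ raysOf σ
    · exact Submodule.mem_sup_left (Submodule.mem_sup_left
        (Submodule.subset_span (h1.1.subset hx)))
    by_cases h2 : ρ ∈ raysOf τ \ raysOf (σ ∩ τ)
    · exact Submodule.mem_sup_left (Submodule.mem_sup_right
        (Submodule.subset_span (h2.1.1.subset hx)))
    · exact Submodule.mem_sup_right (Submodule.subset_span ⟨ρ, ⟨⟨hρ, h1⟩, h2⟩, hx⟩)
  have d6 := Submodule.finrank_mono d5
  have hm := hmax μ hμ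
  unfold nsCone at *
  unfold dimSet at *
  omega

theorem ns_cone_le {d : ℕ} {τ : Set (Fin d → ℝ)} {v0 : Fin d → ℝ} (hτ : IsCC τ)
    {u : (Fin d → ℝ) →ₗ[ℝ] ℝ} (hu : ∀ x ∈ τ, u x = 0) (huv : 0 < u v0)
    (hfin : (raysOf τ).Finite) : nsCone (coneHull (τ ∪ {v0})) ≤ nsCone τ := by
  have hv0 : v0 ≠ 0 := by rintro rfl; simp at huv
  have h1 : raysOf (coneHull (τ ∪ {v0})) ⊆ insert (coneHull {v0}) (raysOf τ) := by
    rintro ρ ⟨hρ, hd⟩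
    obtain ⟨ω, hω, rfl | rfl⟩ := face_cone_inv hτ hρ
    · exact Or.inr ⟨hω, hd⟩
    · left
      have hsp := ray_span hd (subset_coneHull _ (Or.inr rfl)) hv0
      apply Set.Subset.antisymm
      · apply coneHull_min (coneHull_cc _)
        rintro y (hy | rfl)
        · have : y ∈ Submodule.span ℝ {v0} := by
            rw [← hsp]
            exact Submodule.subset_span (subset_coneHull _ (Or.inl hy))
          obtain ⟨a, rfl⟩ := Submodule.mem_span_singleton.1 this
          have h0 := hu _ (hω.subset hy)
          simp [huv.ne'] at h0
          rw [h0, zero_smul]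
          exact (coneHull_cc _).zero
        · exact subset_coneHull _ rfl
      · exact coneHull_mono Set.subset_union_right
  have h2 : (raysOf (coneHull (τ ∪ {v0}))).ncard ≤ (raysOf τ).ncard + 1 :=
    (Set.ncard_le_ncard h1 (hfin.insert _)).trans (Set.ncard_insert_le _ _)
  have h3 : Submodule.span ℝ τ < Submodule.span ℝ (coneHull (τ ∪ {v0})) := by
    refine lt_of_le_of_ne (Submodule.span_mono fun x hx => subset_coneHull _ (Or.inl hx)) fun h => ?_
    have hm : v0 ∈ Submodule.span ℝ τ := by
      rw [h]; exact Submodule.subset_span (subset_coneHull _ (Or.inr rfl))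
    have hk : Submodule.span ℝ τ ≤ LinearMap.ker u := Submodule.span_le.2 hu
    exact huv.ne' (hk hm)
  have h4 := Submodule.finrank_lt_finrank_of_lt h3
  unfold nsCone dimSet
  omega

def GoodSeq {d : ℕ} (F : Set (Set (Fin d → ℝ))) : Prop :=
    ∃ (m : ℕ) (G : Fin (m + 1) → Set (Set (Fin d → ℝ))),
      G 0 = F ∧
      (∀ j, IsFan (G j) ∧ ⋃₀ (G j) = ⋃₀ F) ∧
      (∀ σ ∈ G (Fin.last m), nsCone σ = 0) ∧
      (∀ j : Fin m, ∃ σ, IsMinNonSimpCone (G j.castSucc) σ ∧ 0 < nsCone σ ∧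
        ∃ v : Set (Fin d → ℝ) → (Fin d → ℝ),
          (∀ ρ ∈ raysOf σ, v ρ ∈ ρ ∧ v ρ ≠ 0) ∧
          G j.succ = starSubdiv (G j.castSucc) σ (∑ᶠ ρ ∈ raysOf σ, v ρ))

theorem star_step {d : ℕ} {F : Set (Set (Fin d → ℝ))} (hF : IsFan F) {n : ℤ} (hn : 0 < n)
    (hle : ∀ κ ∈ F, nsCone κ ≤ n) (hex : ∃ κ ∈ F, nsCone κ = n) :
    ∃ σ, IsMinNonSimpCone F σ ∧ 0 < nsCone σ ∧
        ∃ v : Set (Fin d → ℝ) → (Fin d → ℝ),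
          (∀ ρ ∈ raysOf σ, v ρ ∈ ρ ∧ v ρ ≠ 0) ∧
          IsFan (starSubdiv F σ (∑ᶠ ρ ∈ raysOf σ, v ρ)) ∧
          ⋃₀ (starSubdiv F σ (∑ᶠ ρ ∈ raysOf σ, v ρ)) = ⋃₀ F ∧
          (∀ κ ∈ starSubdiv F σ (∑ᶠ ρ ∈ raysOf σ, v ρ), nsCone κ ≤ n) ∧
          {κ ∈ starSubdiv F σ (∑ᶠ ρ ∈ raysOf σ, v ρ) | nsCone κ = n} ⊂
            {κ ∈ F | nsCone κ = n} := by
  classical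
  have hfin : {κ ∈ F | nsCone κ = n}.Finite := hF.1.subset fun κ h => h.1
  have hnsF : nsFan F = n := by
    apply IsGreatest.csSup_eq
    constructor
    · obtain ⟨κ, hκ, h⟩ := hex
      exact ⟨κ, hκ, h⟩
    · rintro _ ⟨κ, hκ, rfl⟩
      exact hle κ hκ
  obtain ⟨σ, hσm⟩ := hfin.exists_minimal (by obtain ⟨κ, hκ, h⟩ := hex; exact ⟨κ, hκ, h⟩)
  have hσ : σ ∈ F := hσm.prop.1
  have hσn : nsCone σ = n := hσm.prop.2
  have hmin : ∀ κ ∈ F, nsCone κ = nsCone σ → κ ⊆ σ → κ = σ := fun κ hκ h hs =>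
    Set.Subset.antisymm hs (hσm.le_of_le ⟨hκ, h.trans hσn⟩ hs)
  have hmax : ∀ κ ∈ F, nsCone κ ≤ nsCone σ := fun κ hκ => by rw [hσn]; exact hle κ hκ
  refine ⟨σ, ⟨hσ, by rw [hσn, hnsF], fun τ hτ h => hmin τ hτ (by rw [h, hnsF, hσn])⟩,
    by rw [hσn]; exact hn, ?_⟩
  have hv : ∀ ρ : Set (Fin d → ℝ), ∃ v, ρ ∈ raysOf σ → v ∈ ρ ∧ v ≠ 0 := by
    intro ρ
    by_cases h : ρ ∈ raysOf σ
    · obtain ⟨v, h1, h2⟩ := ray_exists h.2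
      exact ⟨v, fun _ => ⟨h1, h2⟩⟩
    · exact ⟨0, fun h' => absurd h' h⟩
  choose v hv using hv
  refine ⟨v, hv, ?_⟩
  obtain ⟨hp, hs⟩ := hF.2.1 σ hσ
  have hrf := rays_finite hF hσ
  set v0 := ∑ᶠ ρ ∈ raysOf σ, v ρ with hv0def
  have hv0 : v0 = ∑ ρ ∈ hrf.toFinset, v ρ := finsum_mem_eq_finite_toFinset_sum _ hrf
  have hvσ : ∀ ρ ∈ raysOf σ, v ρ ∈ σ := fun ρ hρ => hρ.1.subset (hv ρ hρ).1
  have hmem : v0 ∈ σ := by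
    rw [hv0]
    exact hp.cc.sum _ _ fun ρ hρ => hvσ ρ (by simpa using hρ)
  have hne : v0 ≠ 0 := by
    intro h0
    have hrn : (raysOf σ).Nonempty := by
      rw [Set.nonempty_iff_ne_empty]
      intro he
      rw [nsCone, he] at hσn
      simp at hσn
      omega
    obtain ⟨ρ, hρ⟩ := hrn
    rw [hv0, ← Finset.add_sum_erase _ _ (hrf.mem_toFinset.2 hρ)] at h0
    apply (hv ρ hρ).2
    apply hs _ (hvσ ρ hρ)
    rw [neg_eq_of_add_eq_zero_right h0]
    refine hp.cc.sum _ _ fun ρ' hρ' => hvσ ρ' ?_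
    exact hrf.mem_toFinset.1 (Finset.mem_of_mem_erase hρ')
  have hrel : ∀ τ ∈ F, v0 ∈ τ → σ ⊆ τ := by
    intro τ hτ hvτ
    obtain ⟨u, hu, he⟩ := (hF.2.2.2 σ hσ τ hτ).1
    have h0 : v0 ∈ {x ∈ σ | u x = 0} := he ▸ (⟨hmem, hvτ⟩ : v0 ∈ σ ∩ τ)
    have h1 := h0.2
    rw [hv0, map_sum, Finset.sum_eq_zero_iff_of_nonneg
      (fun ρ hρ => hu _ (hvσ ρ (hrf.mem_toFinset.1 hρ)))] at h1
    have h2 : σ ⊆ LinearMap.ker u := by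
      apply rays_le hp hs
      intro ρ hρ x hx
      have hx' : x ∈ Submodule.span ℝ ρ := Submodule.subset_span hx
      rw [ray_span hρ.2 (hv ρ hρ).1 (hv ρ hρ).2] at hx'
      refine (Submodule.span_le.2 ?_ : Submodule.span ℝ {v ρ} ≤ LinearMap.ker u) hx'
      rintro _ rfl
      exact h1 ρ (hrf.mem_toFinset.2 hρ)
    intro x hx
    have : x ∈ σ ∩ τ := by rw [he]; exact ⟨hx, h2 hx⟩
    exact this.2
  have hnew : ∀ μ ∈ F, σ ⊆ μ → ∀ τ, IsFaceOf μ τ → ¬ σ ⊆ τ →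
      nsCone (coneHull (τ ∪ {v0})) < n := by
    intro μ hμ hσμ τ hτ hnτ
    have hτF := hF.2.2.1 μ hμ τ hτ
    obtain ⟨u, hu, huv⟩ := star_func hmem hrel hσμ hτ hτF hnτ
    rw [← hσn]
    exact (ns_cone_le (hF.2.1 τ hτF).1.cc hu huv (rays_finite hF hτF)).trans_lt
      (ns_face_lt hF hσ hmax hmin hμ hσμ hτ hnτ)
  refine ⟨star_isFan hF hmem hrel, star_support hF hmem hne, ?_, ?_⟩
  · rintro κ (⟨hκ, -⟩ | ⟨μ, hμ, hσμ, τ, hτ, hnτ, rfl⟩)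
    · exact hle κ hκ
    · exact (hnew μ hμ hσμ τ hτ hnτ).le
  · have hin : ∀ κ ∈ starSubdiv F σ v0, nsCone κ = n → κ ∈ F ∧ ¬ σ ⊆ κ := by
      rintro κ (hκ | ⟨μ, hμ, hσμ, τ, hτ, hnτ, rfl⟩) h
      · exact hκ
      · exact absurd h (hnew μ hμ hσμ τ hτ hnτ).ne
    rw [Set.ssubset_iff_exists]
    exact ⟨fun κ hκ => ⟨(hin κ hκ.1 hκ.2).1, hκ.2⟩, σ, ⟨hσ, hσn⟩, fun h =>
      (hin σ h.1 h.2).2 subset_rfl⟩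

theorem GoodSeq.cons {d : ℕ} {F F' : Set (Set (Fin d → ℝ))} (hF : IsFan F)
    (hsupp : ⋃₀ F' = ⋃₀ F) (h : GoodSeq F')
    (hstep : ∃ σ, IsMinNonSimpCone F σ ∧ 0 < nsCone σ ∧
        ∃ v : Set (Fin d → ℝ) → (Fin d → ℝ),
          (∀ ρ ∈ raysOf σ, v ρ ∈ ρ ∧ v ρ ≠ 0) ∧
          F' = starSubdiv F σ (∑ᶠ ρ ∈ raysOf σ, v ρ)) : GoodSeq F := by
  obtain ⟨m, G, hG0, hG1, hG2, hG3⟩ := h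
  refine ⟨m + 1, Fin.cons F G, rfl, ?_, ?_, ?_⟩
  · intro j
    refine Fin.cases ?_ (fun j => ?_) j
    · exact ⟨hF, rfl⟩
    · simp only [Fin.cons_succ]
      exact ⟨(hG1 j).1, (hG1 j).2.trans hsupp⟩
  · rw [← Fin.succ_last, Fin.cons_succ]
    exact hG2
  · intro j
    refine Fin.cases ?_ (fun j => ?_) j
    · simp only [Fin.castSucc_zero, Fin.cons_zero, Fin.cons_succ, hG0]
      exact hstep
    · rw [← Fin.succ_castSucc]
      simp only [Fin.cons_succ]
      exact hG3 j

theorem good_all {d : ℕ} (n : ℕ) : ∀ (k : ℕ) (F : Set (Set (Fin d → ℝ))), IsFan F →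
    (∀ κ ∈ F, nsCone κ ≤ n) → {κ ∈ F | nsCone κ = n}.ncard ≤ k → GoodSeq F := by
  induction n with
  | zero =>
    intro k F hF hle _
    exact ⟨0, fun _ => F, rfl, fun _ => ⟨hF, rfl⟩, fun κ hκ =>
      le_antisymm (by simpa using hle κ hκ) (ns_nonneg hF hκ), fun j => j.elim0⟩
  | succ n ihn =>
    intro k
    induction k with
    | zero =>
      intro F hF hle hk
      have hfin : {κ ∈ F | nsCone κ = (n + 1 : ℕ)}.Finite := hF.1.subset fun κ h => h.1
      have he := (Set.ncard_eq_zero hfin).1 (Nat.le_zero.1 hk)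
      refine ihn _ F hF (fun κ hκ => ?_) le_rfl
      have h1 := hle κ hκ
      have h2 : nsCone κ ≠ (n + 1 : ℕ) := fun h => by
        have : κ ∈ {κ ∈ F | nsCone κ = (n + 1 : ℕ)} := ⟨hκ, h⟩
        rw [he] at this
        exact this
      push_cast at h1 h2
      omega
    | succ k ihk =>
      intro F hF hle hk
      have hfin : {κ ∈ F | nsCone κ = (n + 1 : ℕ)}.Finite := hF.1.subset fun κ h => h.1
      by_cases hex : ∃ κ ∈ F, nsCone κ = (n + 1 : ℕ)
      · obtain ⟨σ, h1, h2, v, h3, h4, h5, h6, h7⟩ := star_step hF (by positivity) hle hex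
        refine GoodSeq.cons hF h5 (ihk _ h4 h6 ?_) ⟨σ, h1, h2, v, h3, rfl⟩
        have := Set.ncard_lt_ncard h7 hfin
        omega
      · refine ihk F hF hle ?_
        have : {κ ∈ F | nsCone κ = (n + 1 : ℕ)} = ∅ := by
          rw [Set.eq_empty_iff_forall_notMem]
          exact fun κ h => hex ⟨κ, h.1, h.2⟩
        rw [this]; simp

theorem stmt5 {d : ℕ} (F : Set (Set (Fin d → ℝ))) (hF : IsFan F) :
    ∃ (m : ℕ) (G : Fin (m + 1) → Set (Set (Fin d → ℝ))),
      G 0 = F ∧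
      (∀ j, IsFan (G j) ∧ ⋃₀ (G j) = ⋃₀ F) ∧
      (∀ σ ∈ G (Fin.last m), nsCone σ = 0) ∧
      (∀ j : Fin m, ∃ σ, IsMinNonSimpCone (G j.castSucc) σ ∧ 0 < nsCone σ ∧
        ∃ v : Set (Fin d → ℝ) → (Fin d → ℝ),
          (∀ ρ ∈ raysOf σ, v ρ ∈ ρ ∧ v ρ ≠ 0) ∧
          G j.succ = starSubdiv (G j.castSucc) σ (∑ᶠ ρ ∈ raysOf σ, v ρ)) := by
  obtain ⟨b, hb⟩ := (hF.1.image nsCone).bddAbove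
  refine good_all b.toNat _ F hF (fun κ hκ => ?_) le_rfl
  exact (hb ⟨κ, hκ, rfl⟩).trans (Int.self_le_toNat b)
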